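/- For every integer N ≥ 2, any feasible point (f1, g1, l1, m1, c_fl, c_mg, c_ba, t) of the forward lower-bound problem with g1 = l1 or g1 = −l1 has objective value G ≥ 2(N−1). -/

import Mathlib

/-- The objective `G` of the lower-bound problems:
`G = √((c_fl² + c_mg² + N·c_ba²)/2) + (N−1)·√((f1−m1)² + (g1−l1)² + 4t)`. -/
noncomputable def Gobj (N : ℕ) (f1 g1 l1 m1 cfl cmg cba t : ℝ) : ℝ :=
  Real.sqrt ((cfl ^ 2 + cmg ^ 2 + N * cba ^ 2) / 2) +
    ((N : ℝ) - 1) * Real.sqrt ((f1 - m1) ^ 2 + (g1 - l1) ^ 2 + 4 * t)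

/-- Feasible set of the forward lower-bound problem. -/
def FeasFwdLB (N : ℕ) (f1 g1 l1 m1 cfl cmg cba t : ℝ) : Prop :=
  1 ≤ l1 ∧
  ((N : ℝ) - 1) * f1 + cfl + N * cba + N ≤ ((N : ℝ) - 1) * l1 ∧
  -f1 + cfl + N * cba + N ≤ ((N : ℝ) - 1) * l1 ∧
  f1 * m1 ≤ t ∧
  g1 * l1 ≤ t

/-- Any feasible point of the forward lower-bound problem
with `g1 = l1` or `g1 = −l1` has objective value `G ≥ 2(N−1)`. -/
theorem forward_lower_bound_degenerate (N : ℕ) (hN : 2 ≤ N)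
    (f1 g1 l1 m1 cfl cmg cba t : ℝ)
    (hfeas : FeasFwdLB N f1 g1 l1 m1 cfl cmg cba t)
    (hg : g1 = l1 ∨ g1 = -l1) :
    2 * ((N : ℝ) - 1) ≤ Gobj N f1 g1 l1 m1 cfl cmg cba t := by
  obtain ⟨hl, -, -, hfm, hgl⟩ := hfeas
  have hN' : (2 : ℝ) ≤ N := by exact_mod_cast hN
  have hsq : (2 : ℝ) ^ 2 ≤ (f1 - m1) ^ 2 + (g1 - l1) ^ 2 + 4 * t := by
    rcases hg with rfl | rfl
    · nlinarith [sq_nonneg (f1 - m1)]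
    · nlinarith [sq_nonneg (f1 + m1)]
  have hsqrt := mul_le_mul_of_nonneg_left (Real.le_sqrt_of_sq_le hsq)
    (show (0 : ℝ) ≤ (N : ℝ) - 1 by linarith)
  have hnonneg := Real.sqrt_nonneg ((cfl ^ 2 + cmg ^ 2 + N * cba ^ 2) / 2)
  unfold Gobj
  linarith
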